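/- Let k be an algebraically closed field of characteristic zero. Let f₁ ∈ M_{d₁}(k⟨x₁,…,x_g⟩) and f₂ ∈ M_{d₂}(k⟨x₁,…,x_g⟩) be atoms with f₁(0) = I_{d₁} and f₂(0) = I_{d₂}. If for every n ∈ ℕ and every X ∈ M_n(k)^g one has det f₁(X) = 0 if and only if det f₂(X) = 0 (the free loci coincide), then f₁ and f₂ are stably associated. -/

import Mathlib

open Matrix MvPolynomial

noncomputable section

/-- Entrywise evaluation of a `d × d` matrix over the free algebra at a `g`-tuple of
`n × n` matrices over a commutative `k`-algebra `R`, as a `(dn) × (dn)` matrix. -/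
def matEval {k : Type*} [CommRing k] {g d n : ℕ} {R : Type*} [CommRing R] [Algebra k R]
    (f : Matrix (Fin d) (Fin d) (FreeAlgebra k (Fin g)))
    (X : Fin g → Matrix (Fin n) (Fin n) R) :
    Matrix (Fin d × Fin n) (Fin d × Fin n) R :=
  Matrix.of fun p q => (FreeAlgebra.lift k X (f p.1 q.1)) p.2 q.2

/-- Evaluation of a noncommutative polynomial at a `g`-tuple of matrices. -/
def scalarEval {k : Type*} [CommRing k] {g n : ℕ} {R : Type*} [CommRing R] [Algebra k R]
    (f : FreeAlgebra k (Fin g)) (X : Fin g → Matrix (Fin n) (Fin n) R) :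
    Matrix (Fin n) (Fin n) R :=
  FreeAlgebra.lift k X f

/-- An atom of a matrix ring: a non-invertible element that is not a product of two
non-invertible elements. -/
def MatAtom {R : Type*} [Ring R] {d : ℕ} (f : Matrix (Fin d) (Fin d) R) : Prop :=
  ¬IsUnit f ∧ ∀ u v : Matrix (Fin d) (Fin d) R, f = u * v → IsUnit u ∨ IsUnit v

/-- The block-diagonal sum `f ⊕ I_e`. -/
def dSum {R : Type*} [Ring R] {d : ℕ} (f : Matrix (Fin d) (Fin d) R) (e : ℕ) :
    Matrix (Fin (d + e)) (Fin (d + e)) R :=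
  Matrix.reindex finSumFinEquiv finSumFinEquiv (Matrix.fromBlocks f 0 0 1)

/-- Stable associativity of square matrices over a ring. -/
def StablyAssociated {R : Type*} [Ring R] {d₁ d₂ : ℕ}
    (f₁ : Matrix (Fin d₁) (Fin d₁) R) (f₂ : Matrix (Fin d₂) (Fin d₂) R) : Prop :=
  ∃ (e₁ e₂ : ℕ) (h : d₁ + e₁ = d₂ + e₂)
    (P Q : Matrix (Fin (d₁ + e₁)) (Fin (d₁ + e₁)) R),
    IsUnit P ∧ IsUnit Q ∧
      dSum f₁ e₁ = P * Matrix.reindex (finCongr h).symm (finCongr h).symm (dSum f₂ e₂) * Q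

/-- A monic linear pencil as a matrix over the free algebra. -/
def pencilMat {k : Type*} [CommRing k] {g d : ℕ} (A : Fin g → Matrix (Fin d) (Fin d) k) :
    Matrix (Fin d) (Fin d) (FreeAlgebra k (Fin g)) :=
  1 - ∑ j, (A j).map fun a => a • FreeAlgebra.ι k j

/-- The `g`-tuple of `n × n` generic matrices. -/
def genX (k : Type*) [CommRing k] (g n : ℕ) :
    Fin g → Matrix (Fin n) (Fin n) (MvPolynomial (Fin g × Fin n × Fin n) k) :=
  fun j => Matrix.of fun ι κ => MvPolynomial.X (j, ι, κ)

section WeakAlgorithm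

variable {k : Type*} [Field k] {σ : Type*}

/-- The element `a` of the free algebra is supported on words of length less than `n`. -/
def DegLT (n : ℕ) (a : MonoidAlgebra k (FreeMonoid σ)) : Prop :=
  ∀ u, a.coeff u ≠ 0 → u.length < n

lemma DegLT.mono {n m : ℕ} {a : MonoidAlgebra k (FreeMonoid σ)} (h : DegLT n a) (hnm : n ≤ m) :
    DegLT m a := fun u hu => (h u hu).trans_le hnm

lemma degLT_zero (n : ℕ) : DegLT n (0 : MonoidAlgebra k (FreeMonoid σ)) := fun u hu => by
  simp at hu

lemma DegLT.add {n : ℕ} {a b : MonoidAlgebra k (FreeMonoid σ)} (ha : DegLT n a)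
    (hb : DegLT n b) : DegLT n (a + b) := fun u hu => by
  by_contra hn
  have h₁ : a.coeff u = 0 := by by_contra h; exact hn (ha u h)
  have h₂ : b.coeff u = 0 := by by_contra h; exact hn (hb u h)
  simp [h₁, h₂] at hu

lemma DegLT.neg {n : ℕ} {a : MonoidAlgebra k (FreeMonoid σ)} (ha : DegLT n a) :
    DegLT n (-a) := fun u hu => ha u (by simpa using hu)

lemma DegLT.sub {n : ℕ} {a b : MonoidAlgebra k (FreeMonoid σ)} (ha : DegLT n a)
    (hb : DegLT n b) : DegLT n (a - b) := sub_eq_add_neg a b ▸ ha.add hb.neg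

lemma DegLT.sum {n : ℕ} {ι : Type*} (s : Finset ι) (a : ι → MonoidAlgebra k (FreeMonoid σ))
    (h : ∀ i ∈ s, DegLT n (a i)) : DegLT n (∑ i ∈ s, a i) :=
  Finset.sum_induction a (DegLT n) (fun _ _ => DegLT.add) (degLT_zero n) h

lemma DegLT.smul {n : ℕ} {a : MonoidAlgebra k (FreeMonoid σ)} (ha : DegLT n a) (c : k) :
    DegLT n (c • a) := fun u hu => ha u fun h => hu (by simp [h])

lemma DegLT.mul {n m : ℕ} {a b : MonoidAlgebra k (FreeMonoid σ)} (ha : DegLT n a)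
    (hb : DegLT (m + 1) b) : DegLT (n + m) (a * b) := fun u hu => by
  classical
  rw [MonoidAlgebra.coeff_mul, Finsupp.sum] at hu
  obtain ⟨p, -, hp⟩ := Finset.exists_ne_zero_of_sum_ne_zero hu
  rw [Finsupp.sum] at hp
  obtain ⟨q, -, hq⟩ := Finset.exists_ne_zero_of_sum_ne_zero hp
  have hpq : p * q = u := by by_contra h; simp [h] at hq
  rw [if_pos hpq] at hq
  have h₁ := ha p (left_ne_zero_of_mul hq)
  have h₂ := hb q (right_ne_zero_of_mul hq)
  rw [← hpq, FreeMonoid.length_mul]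
  omega

/-- One more than the degree of `a`, with the convention that it vanishes for `a = 0`. -/
def degSucc (a : MonoidAlgebra k (FreeMonoid σ)) : ℕ :=
  a.coeff.support.sup fun u => u.length + 1

lemma degLT_iff {n : ℕ} {a : MonoidAlgebra k (FreeMonoid σ)} : DegLT n a ↔ degSucc a ≤ n := by
  simp [DegLT, degSucc, Finset.sup_le_iff]

lemma degLT_degSucc (a : MonoidAlgebra k (FreeMonoid σ)) : DegLT (degSucc a) a :=
  degLT_iff.2 le_rfl

lemma degSucc_eq_zero {a : MonoidAlgebra k (FreeMonoid σ)} : degSucc a = 0 ↔ a = 0 := by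
  rw [← Nat.le_zero, ← degLT_iff, ← MonoidAlgebra.coeff_eq_zero]
  simp [DegLT, Finsupp.ext_iff]

lemma exists_leading_word {a : MonoidAlgebra k (FreeMonoid σ)} (ha : a ≠ 0) :
    ∃ w, a.coeff w ≠ 0 ∧ w.length + 1 = degSucc a := by
  have hne : a.coeff.support.Nonempty := by
    rw [Finsupp.support_nonempty_iff]; simpa using ha
  obtain ⟨w, hw, h⟩ := Finset.exists_mem_eq_sup _ hne fun u : FreeMonoid σ => u.length + 1
  exact ⟨w, by simpa using hw, h.symm⟩

lemma eq_algebraMap_of_degLT_one {a : MonoidAlgebra k (FreeMonoid σ)} (ha : DegLT 1 a) :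
    a = algebraMap k _ (a.coeff 1) := by
  ext u
  by_cases hu : u = 1
  · subst hu; simp
  · rw [MonoidAlgebra.coe_algebraMap]
    simp only [Function.comp_apply, MonoidAlgebra.coeff_single]
    rw [Finsupp.single_eq_of_ne hu]
    by_contra h
    have := ha u h
    exact hu (FreeMonoid.length_eq_zero.1 (by omega))

/-- Cancellation of the suffix `w`: words ending with `w` lose it, the other words are killed. -/
def suffixCancel (w : FreeMonoid σ) :
    MonoidAlgebra k (FreeMonoid σ) →ₗ[k] MonoidAlgebra k (FreeMonoid σ) where
  toFun a := .ofCoeff (a.coeff.comapDomain (· * w) (mul_left_injective w).injOn)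
  map_add' a b := by ext u; simp
  map_smul' c a := by ext u; simp

@[simp] lemma coeff_suffixCancel (w u : FreeMonoid σ) (a : MonoidAlgebra k (FreeMonoid σ)) :
    (suffixCancel w a).coeff u = a.coeff (u * w) := by
  simp [suffixCancel]

lemma DegLT.suffixCancel {n m : ℕ} {a : MonoidAlgebra k (FreeMonoid σ)} (ha : DegLT (n + m) a)
    {w : FreeMonoid σ} (hw : m ≤ w.length) : DegLT n (suffixCancel w a) := fun u hu => by
  have := ha _ (by simpa using hu)
  rw [FreeMonoid.length_mul] at this
  omega

lemma suffixCancel_eq_zero {a : MonoidAlgebra k (FreeMonoid σ)} {w : FreeMonoid σ}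
    (h : degSucc a ≤ w.length) : suffixCancel w a = 0 := by
  refine degSucc_eq_zero.1 (Nat.le_zero.1 (degLT_iff.1 (DegLT.suffixCancel (m := degSucc a) ?_ h)))
  simpa using degLT_degSucc a

lemma suffixCancel_eq_algebraMap {a : MonoidAlgebra k (FreeMonoid σ)} {w : FreeMonoid σ}
    (h : degSucc a = w.length + 1) : suffixCancel w a = algebraMap k _ (a.coeff w) := by
  have : DegLT 1 (suffixCancel w a) :=
    DegLT.suffixCancel (m := w.length) (degLT_iff.2 (by omega)) le_rfl
  rw [eq_algebraMap_of_degLT_one this]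
  simp

lemma degLT_suffixCancel_mul_sub {n : ℕ} {a : MonoidAlgebra k (FreeMonoid σ)}
    (ha : DegLT (n + 1) a) (b : MonoidAlgebra k (FreeMonoid σ)) (w : FreeMonoid σ) :
    DegLT n (suffixCancel w (a * b) - a * suffixCancel w b) := by
  induction b using MonoidAlgebra.induction_linear with
  | zero => simpa using degLT_zero n
  | add b c hb hc =>
    have := hb.add hc
    rwa [sub_add_sub_comm, ← mul_add, ← map_add, ← map_add, ← mul_add] at this
  | single q c =>
    intro u hu
    by_contra hn
    apply hu
    by_cases hq : ∃ q', q' * w = q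
    · obtain ⟨q', rfl⟩ := hq
      have h : suffixCancel w (MonoidAlgebra.single (q' * w) c) = MonoidAlgebra.single q' c := by
        classical
        ext v
        simp [Finsupp.single_apply]
      have h' : MonoidAlgebra.single (q' * w) c
          = MonoidAlgebra.single q' c * MonoidAlgebra.single w 1 := by
        simp
      rw [h, h', ← mul_assoc]
      simp only [MonoidAlgebra.coeff_sub, Finsupp.coe_sub, Pi.sub_apply, coeff_suffixCancel]
      rw [MonoidAlgebra.coeff_mul_single_eq_coeff_mul u (by simp)]
      simp
    · have h : suffixCancel w (MonoidAlgebra.single q c) = 0 := by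
        classical
        ext v
        have : q ≠ v * w := fun h => hq ⟨v, h.symm⟩
        simp [this]
      rw [h]
      simp only [mul_zero, sub_zero, coeff_suffixCancel]
      by_contra hne
      obtain ⟨p, hp⟩ : ∃ p, p * q = u * w := by
        by_contra hno
        push Not at hno
        exact hne (MonoidAlgebra.coeff_mul_single_of_forall_mul_ne _ _ hno)
      have hp' : a.coeff p ≠ 0 := by
        intro h0
        apply hne
        rw [MonoidAlgebra.coeff_mul_single_eq_coeff_mul p (fun m' _ => by rw [← hp]; simp), h0,
          zero_mul]
      have h₁ := ha p hp'
      have h₂ := congrArg FreeMonoid.length hp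
      simp only [FreeMonoid.length_mul] at h₂
      have h₃ : w.toList <:+ q.toList := by
        refine List.suffix_of_suffix_length_le (l₃ := (u * w).toList) ?_ ?_ ?_
        · exact ⟨u.toList, rfl⟩
        · exact ⟨p.toList, by rw [← hp]; rfl⟩
        · change w.length ≤ q.length
          omega
      obtain ⟨t, ht⟩ := h₃
      exact hq ⟨FreeMonoid.ofList t, ht⟩

/-- The weak algorithm: in a nontrivial relation `∑ aᵢ bᵢ = 1`, either some `aᵢ` is a nonzero
constant, or some `aᵢ` can be lowered in degree by right multiples of the others. -/
lemma weak_algorithm {ι : Type*} [Fintype ι] [DecidableEq ι]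
    (a b : ι → MonoidAlgebra k (FreeMonoid σ)) (hab : ∑ i, a i * b i = 1) :
    (∃ i, ∃ c : k, c ≠ 0 ∧ a i = algebraMap k _ c) ∨
      ∃ i, ∃ c : ι → MonoidAlgebra k (FreeMonoid σ), c i = 1 ∧
        degSucc (∑ l, a l * c l) < degSucc (a i) := by
  classical
  by_cases hconst : ∃ i, degSucc (a i) = 1
  · left
    obtain ⟨i, hi⟩ := hconst
    have := eq_algebraMap_of_degLT_one (degLT_iff.2 hi.le)
    refine ⟨i, _, ?_, this⟩
    intro h0
    rw [h0, map_zero] at this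
    rw [this, degSucc_eq_zero.2 rfl] at hi
    omega
  right
  let I : Finset ι := Finset.univ.filter fun i => a i * b i ≠ 0
  have hI : I.Nonempty := by
    by_contra h
    rw [Finset.not_nonempty_iff_eq_empty, Finset.filter_eq_empty_iff] at h
    rw [Finset.sum_eq_zero fun i _ => not_not.1 (h (Finset.mem_univ i))] at hab
    exact zero_ne_one hab
  obtain ⟨i, hiI, hmax⟩ := I.exists_max_image
    (fun i => toLex (degSucc (a i) + degSucc (b i), degSucc (a i))) hI
  have hi : a i * b i ≠ 0 := by simpa [I] using hiI
  have hai : a i ≠ 0 := left_ne_zero_of_mul hi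
  have hbi : b i ≠ 0 := right_ne_zero_of_mul hi
  have hai' : 2 ≤ degSucc (a i) := by
    have h0 : degSucc (a i) ≠ 0 := mt degSucc_eq_zero.1 hai
    have h1 : degSucc (a i) ≠ 1 := fun h => hconst ⟨i, h⟩
    omega
  obtain ⟨w, hw, hwl⟩ := exists_leading_word hbi
  obtain ⟨n, hn⟩ : ∃ n, degSucc (a i) = n + 1 := ⟨degSucc (a i) - 1, by omega⟩
  have hred : DegLT n (∑ l, a l * suffixCancel w (b l)) := by
    have hdecomp : ∑ l, a l * suffixCancel w (b l) = suffixCancel w 1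
        - ∑ l, (suffixCancel w (a l * b l) - a l * suffixCancel w (b l)) := by
      rw [Finset.sum_sub_distrib, ← map_sum, hab, sub_sub_cancel]
    rw [hdecomp]
    refine DegLT.sub ?_ (DegLT.sum _ _ fun l _ => ?_)
    · refine DegLT.suffixCancel (m := 0) (fun u hu => ?_) (Nat.zero_le _)
      have : u = 1 := by
        by_contra h
        rw [MonoidAlgebra.one_def] at hu
        simp [Finsupp.single_eq_of_ne h] at hu
      subst this
      simp only [FreeMonoid.length_one]
      omega
    · by_cases hl : degSucc (a l) ≤ degSucc (a i)
      · exact degLT_suffixCancel_mul_sub (degLT_iff.2 (by omega)) _ _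
      by_cases hlI : a l * b l = 0
      · have : b l = 0 := by
          refine (mul_eq_zero.1 hlI).resolve_left fun h => hl ?_
          rw [h, degSucc_eq_zero.2 rfl]; omega
        simpa [this] using degLT_zero n
      have hle := hmax l (by simpa [I] using hlI)
      rw [Prod.Lex.toLex_le_toLex] at hle
      have hlt : degSucc (a l) + degSucc (b l) < degSucc (a i) + degSucc (b i) := by
        rcases hle with h | ⟨-, h⟩
        · exact h
        · exact absurd h hl
      rw [suffixCancel_eq_zero (a := b l) (by omega), mul_zero, sub_zero]
      have hbl : degSucc (b l) ≠ 0 := mt degSucc_eq_zero.1 (right_ne_zero_of_mul hlI)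
      refine DegLT.suffixCancel (m := w.length) ?_ le_rfl
      have := (degLT_degSucc (a l)).mul (m := degSucc (b l) - 1) (b := b l)
        (degLT_iff.2 (by omega))
      exact this.mono (by omega)
  refine ⟨i, fun l => ((b i).coeff w)⁻¹ • suffixCancel w (b l), ?_, ?_⟩
  · dsimp only
    rw [suffixCancel_eq_algebraMap hwl.symm, Algebra.smul_def, ← map_mul, inv_mul_cancel₀ hw,
      map_one]
  · simp only [mul_smul_comm, ← Finset.smul_sum]
    have := degLT_iff.1 (hred.smul ((b i).coeff w)⁻¹)
    omega

end WeakAlgorithm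

section Completion

lemma isUnit_one_add_vecMulVec {R ι : Type*} [Ring R] [Fintype ι] [DecidableEq ι] {u w : ι → R}
    (h : w ⬝ᵥ u = 0) : IsUnit (1 + vecMulVec u w) := by
  have h2 : vecMulVec u w * vecMulVec u w = 0 := by
    rw [vecMulVec_mul_vecMulVec, h]
    ext; simp [vecMulVec_apply]
  exact isUnit_iff_exists.2 ⟨1 - vecMulVec u w, by rw [add_mul, mul_sub, mul_sub, h2]; simp,
    by rw [sub_mul, mul_add, mul_add, h2]; simp⟩

lemma vecMul_one_add_vecMulVec {R ι : Type*} [Ring R] [Fintype ι] [DecidableEq ι] (a u w : ι → R) :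
    a ᵥ* (1 + vecMulVec u w) = a + (a ⬝ᵥ u) • w := by
  rw [vecMul_add, vecMul_one, vecMul_vecMulVec]

/-- A unimodular row over a free algebra can be completed to an invertible matrix. -/
lemma exists_isUnit_vecMul_eq_single {k σ ι : Type*} [Field k] [Fintype ι] [DecidableEq ι]
    (a b : ι → MonoidAlgebra k (FreeMonoid σ)) (hab : a ⬝ᵥ b = 1) (i₀ : ι) :
    ∃ U : Matrix ι ι (MonoidAlgebra k (FreeMonoid σ)), IsUnit U ∧ a ᵥ* U = Pi.single i₀ 1 := by
  induction hN : ∑ i, degSucc (a i) using Nat.strong_induction_on generalizing a b with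
  | _ N ih =>
  subst hN
  have step : ∀ U : Matrix ι ι (MonoidAlgebra k (FreeMonoid σ)), IsUnit U →
      (∃ V : Matrix ι ι (MonoidAlgebra k (FreeMonoid σ)), IsUnit V ∧
        (a ᵥ* U) ᵥ* V = Pi.single i₀ 1) →
      ∃ V : Matrix ι ι (MonoidAlgebra k (FreeMonoid σ)), IsUnit V ∧ a ᵥ* V = Pi.single i₀ 1 := by
    rintro U hU ⟨V, hV, h⟩
    exact ⟨U * V, hU.mul hV, by rw [← vecMul_vecMul, h]⟩
  rcases weak_algorithm a b hab with ⟨i, c, hc, hi⟩ | ⟨i, c, hci, hdeg⟩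
  · have clear : ∀ a' : ι → MonoidAlgebra k (FreeMonoid σ), a' i₀ = 1 →
        ∃ V : Matrix ι ι (MonoidAlgebra k (FreeMonoid σ)), IsUnit V ∧
          a' ᵥ* V = Pi.single i₀ 1 := fun a' h => by
      refine ⟨1 + vecMulVec (Pi.single i₀ 1) (Pi.single i₀ 1 - a'),
        isUnit_one_add_vecMulVec (by simp [h]), ?_⟩
      rw [vecMul_one_add_vecMulVec]
      simp [h]
    have main : ∀ a' : ι → MonoidAlgebra k (FreeMonoid σ), a' i = 1 →
        ∃ V : Matrix ι ι (MonoidAlgebra k (FreeMonoid σ)), IsUnit V ∧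
          a' ᵥ* V = Pi.single i₀ 1 := fun a' h => by
      by_cases hii : i₀ = i
      · subst hii; exact clear a' h
      obtain ⟨V, hV, h'⟩ := clear (a' ᵥ* (1 + vecMulVec (Pi.single i (1 - a' i₀))
        (Pi.single i₀ 1))) (by rw [vecMul_one_add_vecMulVec]; simp [h])
      have hunit : IsUnit (1 + vecMulVec (Pi.single i (1 - a' i₀)) (Pi.single i₀ 1)) :=
        isUnit_one_add_vecMulVec (by simp [hii])
      exact ⟨_, hunit.mul hV, by rw [← vecMul_vecMul, h']⟩
    obtain ⟨V, hV, h⟩ := main ((c⁻¹ : k) • a) (by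
      rw [Pi.smul_apply, hi, Algebra.smul_def, ← map_mul, inv_mul_cancel₀ hc, map_one])
    refine ⟨(c⁻¹ : k) • V, ?_, by rw [vecMul_smul, ← smul_vecMul, h]⟩
    exact hV.smul (Units.mk0 _ (inv_ne_zero hc))
  · have hval : a ᵥ* (1 + vecMulVec (c - Pi.single i 1) (Pi.single i 1))
        = Function.update a i (∑ l, a l * c l) := by
      rw [vecMul_one_add_vecMulVec, dotProduct_sub]
      ext1 j
      by_cases hj : j = i
      · subst hj; simp only [dotProduct_single]; simp [dotProduct]
      · simp [hj]
    have hunit : IsUnit (1 + vecMulVec (c - Pi.single i 1) (Pi.single i 1)) :=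
      isUnit_one_add_vecMulVec (by simp [hci])
    refine step _ hunit ?_
    obtain ⟨u, hu⟩ := hunit
    refine ih _ ?_ _ ((u⁻¹ : (Matrix ι ι (MonoidAlgebra k (FreeMonoid σ)))ˣ).1 *ᵥ b) ?_ rfl
    · rw [hval]
      refine Finset.sum_lt_sum (fun j _ => ?_) ⟨i, Finset.mem_univ i, by simpa using hdeg⟩
      by_cases hj : j = i
      · subst hj; simpa using hdeg.le
      · simp [hj]
    · rw [← hu, ← dotProduct_mulVec, mulVec_mulVec, Units.mul_inv, one_mulVec, hab]

/-- The matrix `f` is a product of two non-invertible square matrices of the same size. -/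
def Splits {R ι : Type*} [Ring R] [Fintype ι] [DecidableEq ι] (f : Matrix ι ι R) : Prop :=
  ∃ u v : Matrix ι ι R, f = u * v ∧ ¬ IsUnit u ∧ ¬ IsUnit v

lemma exists_isUnit_vecMul_eq_single_freeAlgebra {k σ ι : Type*} [Field k] [Fintype ι]
    [DecidableEq ι] (a b : ι → FreeAlgebra k σ) (hab : a ⬝ᵥ b = 1) (i₀ : ι) :
    ∃ U : Matrix ι ι (FreeAlgebra k σ), IsUnit U ∧ a ᵥ* U = Pi.single i₀ 1 := by
  let φ := (FreeAlgebra.equivMonoidAlgebraFreeMonoid (R := k) (X := σ)).toRingEquiv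
  obtain ⟨U, hU, h⟩ := exists_isUnit_vecMul_eq_single (φ ∘ a) (φ ∘ b) (by
    have := congrArg φ hab
    simpa [dotProduct] using this) i₀
  refine ⟨φ.symm.mapMatrix U, hU.map φ.symm.mapMatrix, ?_⟩
  ext1 j
  have := congrArg φ.symm (congrFun h j)
  rw [vecMul, dotProduct, map_sum] at this
  simp only [Function.comp_apply, map_mul, RingEquiv.symm_apply_apply] at this
  rw [vecMul, dotProduct]
  refine this.trans ?_
  by_cases hj : j = i₀
  · subst hj; simp
  · simp [hj]

lemma isUnit_fromBlocks_of_isUnit {R m n : Type*} [Ring R] [Fintype m] [DecidableEq m]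
    [Fintype n] [DecidableEq n] {u : Matrix m m R} {v : Matrix n n R} (s : Matrix m n R)
    (hu : IsUnit u) (hv : IsUnit v) : IsUnit (fromBlocks u s 0 v) := by
  obtain ⟨u', h₁, h₂⟩ := isUnit_iff_exists.1 hu
  obtain ⟨v', h₃, h₄⟩ := isUnit_iff_exists.1 hv
  refine isUnit_iff_exists.2 ⟨fromBlocks u' (-(u' * s * v')) 0 v', ?_, ?_⟩
  · rw [fromBlocks_multiply, ← fromBlocks_one]
    simp [← Matrix.mul_assoc, h₁, h₃]
  · rw [fromBlocks_multiply, ← fromBlocks_one]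
    simp [Matrix.mul_assoc, h₂, h₄]

lemma Splits.of_fromBlocks_unit {k σ m : Type*} [Field k] [Fintype m] [DecidableEq m]
    {f : Matrix m m (FreeAlgebra k σ)}
    (h : Splits (fromBlocks f 0 0 (1 : Matrix Unit Unit (FreeAlgebra k σ)))) : Splits f := by
  obtain ⟨G, H, hGH, hG, hH⟩ := h
  obtain ⟨_, ⟨U, rfl⟩, hUG⟩ := exists_isUnit_vecMul_eq_single_freeAlgebra (G (Sum.inr ()))
    (fun i => H i (Sum.inr ())) (congrFun₂ hGH (Sum.inr ()) (Sum.inr ())).symm (Sum.inr ())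
  have hrow : ∀ M : Matrix (m ⊕ Unit) (m ⊕ Unit) (FreeAlgebra k σ),
      M (Sum.inr ()) = Pi.single (Sum.inr ()) 1 → M = fromBlocks M.toBlocks₁₁ M.toBlocks₁₂ 0 1 := by
    intro M hM
    conv_lhs => rw [← fromBlocks_toBlocks M]
    congr 1
    · ext i j
      simp [toBlocks₂₁, hM]
    · ext i j
      simp [toBlocks₂₂, hM]
  have hprod : fromBlocks f 0 0 1 = (G * U.1) * ((U⁻¹).1 * H) := by
    rw [hGH, mul_assoc, ← mul_assoc U.1, Units.mul_inv, one_mul]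
  have hG' := hrow (G * U.1) hUG
  have hH' := hrow ((U⁻¹).1 * H) (by
    have h1 : (fromBlocks f 0 0 1 : Matrix (m ⊕ Unit) (m ⊕ Unit) (FreeAlgebra k σ)) (Sum.inr ())
        = Pi.single (Sum.inr ()) 1 := by
      ext1 j
      rcases j with j | j <;> simp
    rw [hprod] at h1
    have h2 : ((G * U.1) * ((U⁻¹).1 * H)) (Sum.inr ())
        = (G (Sum.inr ()) ᵥ* U.1) ᵥ* ((U⁻¹).1 * H) := rfl
    rw [h2, hUG, single_one_vecMul] at h1
    exact h1)
  rw [hG', hH', fromBlocks_multiply] at hprod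
  refine ⟨(G * U.1).toBlocks₁₁, ((U⁻¹).1 * H).toBlocks₁₁, ?_, fun hu => hG ?_, fun hv => hH ?_⟩
  · simpa using congrArg toBlocks₁₁ hprod
  · rw [← Units.isUnit_mul_units G U, hG']
    exact isUnit_fromBlocks_of_isUnit _ hu isUnit_one
  · rw [← Units.isUnit_units_mul U⁻¹ H, hH']
    exact isUnit_fromBlocks_of_isUnit _ hv isUnit_one

lemma Splits.reindex {R ι κ : Type*} [Ring R] [Fintype ι] [DecidableEq ι] [Fintype κ]
    [DecidableEq κ] {f : Matrix ι ι R} (h : Splits f) (e : ι ≃ κ) :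
    Splits (Matrix.reindex e e f) := by
  obtain ⟨u, v, rfl, hu, hv⟩ := h
  refine ⟨reindexRingEquiv R e u, reindexRingEquiv R e v, map_mul (reindexRingEquiv R e) u v,
    ?_, ?_⟩
  · rwa [MulEquiv.isUnit_map]
  · rwa [MulEquiv.isUnit_map]

/-- Over a free algebra, non-trivial factorizations of `f ⊕ I` come from those of `f`. -/
lemma Splits.of_fromBlocks_one {k σ m : Type*} [Field k] [Fintype m] [DecidableEq m]
    (n : Type*) [Fintype n] [DecidableEq n] {f : Matrix m m (FreeAlgebra k σ)}
    (h : Splits (fromBlocks f 0 0 (1 : Matrix n n (FreeAlgebra k σ)))) : Splits f := by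
  classical
  let P : ∀ (n : Type _) [Fintype n], Prop := fun n _ => ∀ [DecidableEq n],
    Splits (fromBlocks f 0 0 (1 : Matrix n n (FreeAlgebra k σ))) → Splits f
  refine Fintype.induction_empty_option (P := P) ?_ ?_ ?_ n h
  · intro α β _ e ih _ h
    let _ := Fintype.ofEquiv β e.symm
    have h' := h.reindex ((Equiv.refl m).sumCongr e.symm)
    refine ih ?_
    convert h' using 1
    ext (i | i) (j | j) <;> simp [one_apply]
  · intro _ h
    have h' := h.reindex (Equiv.sumEmpty m PEmpty)
    convert h' using 1
    ext i j
    simp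
  · intro α _ ih _ h
    refine ih (Splits.of_fromBlocks_unit ?_)
    have h' := h.reindex (((Equiv.refl m).sumCongr (Equiv.optionEquivSumPUnit α)).trans
      (Equiv.sumAssoc m α Unit).symm)
    convert h' using 1
    ext ((i | i) | i) ((j | j) | j) <;> simp [one_apply]

end Completion

section StableEquivalence

variable {R : Type*} [Ring R] {m n p : Type*} [Fintype m] [DecidableEq m] [Fintype n]
  [DecidableEq n] [Fintype p] [DecidableEq p]

/-- Homotopy equivalence of the two-term complexes given by left multiplication with `f` and `g`;
it is an index-free form of stable associativity. -/
def HtpyEquiv (f : Matrix m m R) (g : Matrix n n R) : Prop :=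
  ∃ (b c : Matrix n m R) (b' c' : Matrix m n R) (h : Matrix m m R) (h' : Matrix n n R),
    b * f = g * c ∧ b' * g = f * c' ∧ b' * b = 1 + f * h ∧ c' * c = 1 + h * f ∧
      b * b' = 1 + g * h' ∧ c * c' = 1 + h' * g

lemma HtpyEquiv.symm {f : Matrix m m R} {g : Matrix n n R} (H : HtpyEquiv f g) :
    HtpyEquiv g f := by
  obtain ⟨b, c, b', c', h, h', h₁, h₂, h₃, h₄, h₅, h₆⟩ := H
  exact ⟨b', c', b, c, h', h, h₂, h₁, h₅, h₆, h₃, h₄⟩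

lemma HtpyEquiv.trans {f : Matrix m m R} {g : Matrix n n R} {e : Matrix p p R}
    (H₁ : HtpyEquiv f g) (H₂ : HtpyEquiv g e) : HtpyEquiv f e := by
  obtain ⟨b, c, b', c', h, h', h₁, h₂, h₃, h₄, h₅, h₆⟩ := H₁
  obtain ⟨d, a, d', a', i, i', i₁, i₂, i₃, i₄, i₅, i₆⟩ := H₂
  refine ⟨d * b, a * c, b' * d', c' * a', h + c' * i * b, i' + a * h' * d', ?_, ?_, ?_, ?_, ?_, ?_⟩
  · rw [Matrix.mul_assoc, h₁, ← Matrix.mul_assoc, i₁, Matrix.mul_assoc]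
  · rw [Matrix.mul_assoc, i₂, ← Matrix.mul_assoc, h₂, Matrix.mul_assoc]
  · calc b' * d' * (d * b) = b' * (d' * d) * b := by simp only [Matrix.mul_assoc]
      _ = b' * b + b' * g * i * b := by
        rw [i₃, Matrix.mul_add, Matrix.add_mul]; simp only [Matrix.mul_assoc, Matrix.one_mul]
      _ = _ := by rw [h₃, h₂, Matrix.mul_add]; simp only [Matrix.mul_assoc, add_assoc]
  · calc c' * a' * (a * c) = c' * (a' * a) * c := by simp only [Matrix.mul_assoc]
      _ = c' * c + c' * i * (g * c) := by
        rw [i₄, Matrix.mul_add, Matrix.add_mul]; simp only [Matrix.mul_assoc, Matrix.one_mul]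
      _ = _ := by rw [h₄, ← h₁, Matrix.add_mul]; simp only [Matrix.mul_assoc, add_assoc]
  · calc d * b * (b' * d') = d * (b * b') * d' := by simp only [Matrix.mul_assoc]
      _ = d * d' + d * g * h' * d' := by
        rw [h₅, Matrix.mul_add, Matrix.add_mul]; simp only [Matrix.mul_assoc, Matrix.one_mul]
      _ = _ := by rw [i₅, i₁, Matrix.mul_add]; simp only [Matrix.mul_assoc, add_assoc]
  · calc a * c * (c' * a') = a * (c * c') * a' := by simp only [Matrix.mul_assoc]
      _ = a * a' + a * h' * (g * a') := by
        rw [h₆, Matrix.mul_add, Matrix.add_mul]; simp only [Matrix.mul_assoc, Matrix.one_mul]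
      _ = _ := by rw [i₆, ← i₂, Matrix.add_mul]; simp only [Matrix.mul_assoc, add_assoc]

lemma HtpyEquiv.of_mul_eq_mul {f : Matrix m m R} {g : Matrix n n R} {b c : Matrix n m R}
    {b' c' : Matrix m n R} (hb : b * b' = 1) (hb' : b' * b = 1) (hc : c * c' = 1)
    (hc' : c' * c = 1) (h : b * f = g * c) : HtpyEquiv f g := by
  refine ⟨b, c, b', c', 0, 0, h, ?_, ?_, ?_, ?_, ?_⟩
  · calc b' * g = b' * (g * c) * c' := by
          rw [Matrix.mul_assoc, Matrix.mul_assoc, hc, Matrix.mul_one]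
      _ = f * c' := by rw [← h, ← Matrix.mul_assoc, hb', Matrix.one_mul]
  all_goals simp [*]

lemma HtpyEquiv.of_isUnit_mul {f u : Matrix m m R} (hu : IsUnit u) : HtpyEquiv (u * f) f := by
  obtain ⟨v, h₁, h₂⟩ := isUnit_iff_exists.1 hu
  exact .of_mul_eq_mul (b := v) (c := 1) (b' := u) (c' := 1) h₂ h₁ (by simp) (by simp)
    (by rw [← Matrix.mul_assoc, h₂]; simp)

lemma HtpyEquiv.of_mul_isUnit {f u : Matrix m m R} (hu : IsUnit u) : HtpyEquiv (f * u) f := by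
  obtain ⟨v, h₁, h₂⟩ := isUnit_iff_exists.1 hu
  exact .of_mul_eq_mul (b := 1) (c := u) (b' := 1) (c' := v) (by simp) (by simp) h₁ h₂
    (by simp)

lemma HtpyEquiv.fromBlocks_one_right (f : Matrix m m R) :
    HtpyEquiv (fromBlocks f 0 0 (1 : Matrix n n R)) f := by
  refine ⟨fromCols 1 0, fromCols 1 0, fromRows 1 0, fromRows 1 0, fromBlocks 0 0 0 (-1), 0, ?_, ?_,
    ?_, ?_, ?_, ?_⟩
  · simp [fromCols_mul_fromBlocks, mul_fromCols]
  · simp [fromBlocks_mul_fromRows, fromRows_mul]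
  · rw [← fromBlocks_one, fromBlocks_multiply, fromBlocks_add]
    ext (i | i) (j | j) <;> simp
  · rw [← fromBlocks_one, fromBlocks_multiply, fromBlocks_add]
    ext (i | i) (j | j) <;> simp
  · simp [fromCols_mul_fromRows]
  · simp [fromCols_mul_fromRows]

lemma HtpyEquiv.fromBlocks_one_left (f : Matrix m m R) :
    HtpyEquiv (fromBlocks (1 : Matrix n n R) 0 0 f) f := by
  refine ⟨fromCols 0 1, fromCols 0 1, fromRows 0 1, fromRows 0 1, fromBlocks (-1) 0 0 0, 0, ?_, ?_,
    ?_, ?_, ?_, ?_⟩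
  · simp [fromCols_mul_fromBlocks, mul_fromCols]
  · simp [fromBlocks_mul_fromRows, fromRows_mul]
  · rw [← fromBlocks_one, fromBlocks_multiply, fromBlocks_add]
    ext (i | i) (j | j) <;> simp
  · rw [← fromBlocks_one, fromBlocks_multiply, fromBlocks_add]
    ext (i | i) (j | j) <;> simp
  · simp [fromCols_mul_fromRows]
  · simp [fromCols_mul_fromRows]

lemma HtpyEquiv.fromBlocks_right {f : Matrix m m R} {v : Matrix n n R} (s : Matrix m n R)
    (hv : IsUnit v) : HtpyEquiv (fromBlocks f s 0 v) f := by
  have : fromBlocks f s 0 v = fromBlocks 1 s 0 v * fromBlocks f 0 0 1 := by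
    simp [fromBlocks_multiply]
  rw [this]
  exact (HtpyEquiv.of_isUnit_mul (isUnit_fromBlocks_of_isUnit s isUnit_one hv)).trans
    (.fromBlocks_one_right f)

lemma HtpyEquiv.fromBlocks_left {u : Matrix m m R} {f : Matrix n n R} (s : Matrix m n R)
    (hu : IsUnit u) : HtpyEquiv (fromBlocks u s 0 f) f := by
  have : fromBlocks u s 0 f = fromBlocks 1 0 0 f * fromBlocks u s 0 1 := by
    simp [fromBlocks_multiply]
  rw [this]
  exact (HtpyEquiv.of_mul_isUnit (isUnit_fromBlocks_of_isUnit s hu isUnit_one)).trans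
    (.fromBlocks_one_left f)

lemma HtpyEquiv.isUnit {f : Matrix m m R} {g : Matrix n n R} (H : HtpyEquiv f g)
    (hg : IsUnit g) : IsUnit f := by
  obtain ⟨b, c, b', c', h, h', h₁, h₂, h₃, h₄, h₅, h₆⟩ := H
  obtain ⟨e, he₁, he₂⟩ := isUnit_iff_exists.1 hg
  have hc : c = e * b * f := by
    rw [Matrix.mul_assoc, h₁, ← Matrix.mul_assoc, he₂, Matrix.one_mul]
  have hb' : b' = f * c' * e := by
    rw [← h₂, Matrix.mul_assoc, he₁, Matrix.mul_one]
  refine isUnit_iff_exists.2 ⟨c' * e * b - h, ?_, ?_⟩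
  · rw [hb'] at h₃
    rw [mul_sub, sub_eq_iff_eq_add, ← h₃]
    simp only [Matrix.mul_assoc]
  · rw [hc] at h₄
    rw [sub_mul, sub_eq_iff_eq_add, ← h₄]
    simp only [Matrix.mul_assoc]

lemma HtpyEquiv.isUnit_iff {f : Matrix m m R} {g : Matrix n n R} (H : HtpyEquiv f g) :
    IsUnit f ↔ IsUnit g := ⟨H.symm.isUnit, H.isUnit⟩

lemma HtpyEquiv.map {S : Type*} [Ring S] {f : Matrix m m R} {g : Matrix n n R}
    (H : HtpyEquiv f g) (φ : R →+* S) : HtpyEquiv (f.map φ) (g.map φ) := by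
  obtain ⟨b, c, b', c', h, h', h₁, h₂, h₃, h₄, h₅, h₆⟩ := H
  refine ⟨b.map φ, c.map φ, b'.map φ, c'.map φ, h.map φ, h'.map φ, ?_, ?_, ?_, ?_, ?_, ?_⟩
  · rw [← Matrix.map_mul, h₁, Matrix.map_mul]
  · rw [← Matrix.map_mul, h₂, Matrix.map_mul]
  · rw [← Matrix.map_mul, h₃, Matrix.map_add _ (map_add φ), Matrix.map_mul,
      Matrix.map_one _ (map_zero φ) (map_one φ)]
  · rw [← Matrix.map_mul, h₄, Matrix.map_add _ (map_add φ), Matrix.map_mul,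
      Matrix.map_one _ (map_zero φ) (map_one φ)]
  · rw [← Matrix.map_mul, h₅, Matrix.map_add _ (map_add φ), Matrix.map_mul,
      Matrix.map_one _ (map_zero φ) (map_one φ)]
  · rw [← Matrix.map_mul, h₆, Matrix.map_add _ (map_add φ), Matrix.map_mul,
      Matrix.map_one _ (map_zero φ) (map_one φ)]

lemma isUnit_fromBlocks_one_zero_one (s : Matrix n m R) :
    IsUnit (fromBlocks (1 : Matrix m m R) 0 s (1 : Matrix n n R)) :=
  isUnit_iff_exists.2 ⟨fromBlocks 1 0 (-s) 1, by simp [fromBlocks_multiply],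
    by simp [fromBlocks_multiply]⟩

/-- Homotopy equivalence implies stable associativity. -/
lemma HtpyEquiv.exists_isUnit {f : Matrix m m R} {g : Matrix n n R} (H : HtpyEquiv f g) :
    ∃ P Q : Matrix (m ⊕ n) (m ⊕ n) R, IsUnit P ∧ IsUnit Q ∧
      fromBlocks f 0 0 1 = P * fromBlocks 1 0 0 g * Q := by
  obtain ⟨b, c, b', c', h, h', h₁, h₂, h₃, h₄, h₅, h₆⟩ := H
  have hl : fromBlocks (-h) (-c') b g * fromBlocks f b' (-c) (-h')
      = fromBlocks 1 (-(h * b') + c' * h') 0 1 := by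
    rw [fromBlocks_multiply]
    simp [h₁, h₄, h₅]
  have hr : fromBlocks f b' (-c) (-h') * fromBlocks (-h) (-c') b g
      = fromBlocks 1 0 (c * h - h' * b) 1 := by
    rw [fromBlocks_multiply]
    simp [h₂, h₃, h₆, sub_eq_add_neg]
  refine ⟨fromBlocks 1 (-b') 0 1 * fromBlocks 1 0 b 1, fromBlocks f b' (-c) (-h'),
    (isUnit_fromBlocks_of_isUnit _ isUnit_one isUnit_one).mul (isUnit_fromBlocks_one_zero_one b),
    isUnit_iff_exists_and_exists.2 ⟨?_, ?_⟩, ?_⟩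
  · obtain ⟨t, ht, -⟩ := isUnit_iff_exists.1 (isUnit_fromBlocks_one_zero_one (c * h - h' * b))
    exact ⟨_, by rw [← hr, mul_assoc] at ht; exact ht⟩
  · obtain ⟨t, -, ht⟩ := isUnit_iff_exists.1 (isUnit_fromBlocks_of_isUnit
      (-(h * b') + c' * h') (isUnit_one (M := Matrix m m R)) (isUnit_one (M := Matrix n n R)))
    exact ⟨_, by rw [← hl, ← mul_assoc] at ht; exact ht⟩
  · have key : fromBlocks 1 0 b 1 * fromBlocks 1 0 0 g * fromBlocks f b' (-c) (-h')
        = fromBlocks f b' 0 1 := by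
      rw [fromBlocks_multiply, fromBlocks_multiply]
      simp [h₁, h₅]
    rw [mul_assoc, mul_assoc, ← mul_assoc (fromBlocks 1 0 b 1), key, fromBlocks_multiply]
    simp

end StableEquivalence

section Linearization

variable {k : Type*} [Field k] {σ : Type*}

/-- A constant matrix over the free algebra. -/
def constMat (σ : Type*) {m n : Type*} (C : Matrix m n k) : Matrix m n (FreeAlgebra k σ) :=
  C.map (algebraMap k (FreeAlgebra k σ))

lemma fromCols_constMat {m n p : Type*} (A : Matrix m n k) (C : Matrix m p k) :
    fromCols (constMat σ A) (constMat σ C) = constMat σ (fromCols A C) := by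
  ext i (j | j) <;> simp [constMat]

lemma constMat_mul {m n p : Type*} [Fintype n] (C : Matrix m n k) (D : Matrix n p k) :
    constMat σ (C * D) = constMat σ C * constMat σ D := Matrix.map_mul

lemma constMat_add {m n : Type*} (C D : Matrix m n k) :
    constMat σ (C + D) = constMat σ C + constMat σ D := Matrix.map_add _ (map_add _) _ _

lemma constMat_one {m : Type*} [DecidableEq m] : constMat σ (1 : Matrix m m k) = 1 :=
  Matrix.map_one _ (map_zero _) (map_one _)

variable [Fintype σ]

/-- A homogeneous linear matrix over the free algebra. -/
def linMat {m n : Type*} (A : σ → Matrix m n k) : Matrix m n (FreeAlgebra k σ) :=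
  ∑ j, (A j).map fun a => a • FreeAlgebra.ι k j

lemma linMat_apply {m n : Type*} (A : σ → Matrix m n k) (i : m) (j : n) :
    linMat A i j = ∑ l, A l i j • FreeAlgebra.ι k l := by
  simp [linMat, Matrix.sum_apply]

@[simp] lemma linMat_zero {m n : Type*} :
    linMat (fun _ => 0 : σ → Matrix m n k) = 0 := by
  ext i j; simp [linMat_apply]

lemma linMat_neg {m n : Type*} (A : σ → Matrix m n k) :
    linMat (fun l => -A l) = -linMat A := by
  ext i j; simp [linMat_apply]

lemma constMat_mul_linMat {m n p : Type*} [Fintype n] (C : Matrix m n k)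
    (A : σ → Matrix n p k) : constMat σ C * linMat A = linMat fun l => C * A l := by
  ext i j
  simp only [mul_apply, linMat_apply, constMat, map_apply, Finset.mul_sum, Finset.sum_smul]
  rw [Finset.sum_comm]
  simp [← Algebra.smul_def, smul_smul, mul_comm]

lemma linMat_mul_constMat {m n p : Type*} [Fintype n] (A : σ → Matrix m n k)
    (C : Matrix n p k) : linMat A * constMat σ C = linMat fun l => A l * C := by
  ext i j
  simp only [mul_apply, linMat_apply, constMat, map_apply, Finset.sum_mul, Finset.sum_smul]
  rw [Finset.sum_comm]
  simp [← Algebra.commutes, ← Algebra.smul_def, smul_smul]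

lemma fromBlocks_linMat {m n p q : Type*} (A : σ → Matrix m p k) (B : σ → Matrix m q k)
    (C : σ → Matrix n p k) (D : σ → Matrix n q k) :
    fromBlocks (linMat A) (linMat B) (linMat C) (linMat D)
      = linMat fun l => fromBlocks (A l) (B l) (C l) (D l) := by
  ext (i | i) (j | j) <;> simp [linMat_apply]

lemma fromRows_linMat {m n p : Type*} (A : σ → Matrix m p k) (C : σ → Matrix n p k) :
    fromRows (linMat A) (linMat C) = linMat fun l => fromRows (A l) (C l) := by
  ext (i | i) j <;> simp [linMat_apply]

/-- The matrix `p` has the form `p₀ + c (1 - n)⁻¹ b` with `p₀`, `c` constant, `b`, `n` linear and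
`1 - n` invertible. -/
def HasRealization {m : Type} [Fintype m] (p : Matrix m m (FreeAlgebra k σ)) : Prop :=
  ∃ (N : Type) (_ : Fintype N) (_ : DecidableEq N) (p₀ : Matrix m m k) (c : Matrix m N k)
    (B : σ → Matrix N m k) (A : σ → Matrix N N k) (u : Matrix N N (FreeAlgebra k σ)),
    (1 - linMat A) * u = 1 ∧ u * (1 - linMat A) = 1 ∧
      p = constMat σ p₀ + constMat σ c * u * linMat B

variable {m : Type} [Fintype m]

lemma HasRealization.add {p q : Matrix m m (FreeAlgebra k σ)}
    (hp : HasRealization p) (hq : HasRealization q) : HasRealization (p + q) := by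
  obtain ⟨N, _, _, p₀, c, B, A, u, h₁, h₂, rfl⟩ := hp
  obtain ⟨M, _, _, q₀, d, D, E, v, i₁, i₂, rfl⟩ := hq
  refine ⟨N ⊕ M, inferInstance, inferInstance, p₀ + q₀, fromCols c d, fun l => fromRows (B l) (D l),
    fun l => fromBlocks (A l) 0 0 (E l), fromBlocks u 0 0 v, ?_, ?_, ?_⟩
  · rw [← fromBlocks_linMat, linMat_zero, ← fromBlocks_one, sub_eq_add_neg, fromBlocks_neg,
      fromBlocks_add, fromBlocks_multiply]
    simp [← sub_eq_add_neg, h₁, i₁]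
  · rw [← fromBlocks_linMat, linMat_zero, ← fromBlocks_one, sub_eq_add_neg, fromBlocks_neg,
      fromBlocks_add, fromBlocks_multiply]
    simp [← sub_eq_add_neg, h₂, i₂]
  · rw [← fromRows_linMat, ← fromCols_constMat, fromCols_mul_fromBlocks, fromCols_mul_fromRows,
      constMat_add]
    simp only [Matrix.mul_zero, add_zero, zero_add]
    abel

lemma HasRealization.mul {p q : Matrix m m (FreeAlgebra k σ)}
    (hp : HasRealization p) (hq : HasRealization q) : HasRealization (p * q) := by
  obtain ⟨N, _, _, p₀, c, B, A, u, h₁, h₂, rfl⟩ := hp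
  obtain ⟨M, _, _, q₀, d, D, E, v, i₁, i₂, rfl⟩ := hq
  refine ⟨N ⊕ M, inferInstance, inferInstance, p₀ * q₀, fromCols c (p₀ * d),
    fun l => fromRows (B l * q₀) (D l), fun l => fromBlocks (A l) (B l * d) 0 (E l),
    fromBlocks u (u * (linMat B * constMat σ d) * v) 0 v, ?_, ?_, ?_⟩
  · rw [← fromBlocks_linMat, linMat_zero, ← fromBlocks_one, sub_eq_add_neg, fromBlocks_neg,
      fromBlocks_add, fromBlocks_multiply, ← linMat_mul_constMat]
    simp only [← sub_eq_add_neg, ← Matrix.mul_assoc, h₁, i₁]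
    simp
  · rw [← fromBlocks_linMat, linMat_zero, ← fromBlocks_one, sub_eq_add_neg, fromBlocks_neg,
      fromBlocks_add, fromBlocks_multiply, ← linMat_mul_constMat]
    simp only [← sub_eq_add_neg, Matrix.mul_assoc, h₂, i₂]
    simp
  · rw [← fromRows_linMat, ← fromCols_constMat, fromCols_mul_fromBlocks, fromCols_mul_fromRows,
      constMat_mul, constMat_mul, ← linMat_mul_constMat]
    simp only [Matrix.mul_zero, add_zero, Matrix.mul_add, Matrix.add_mul, Matrix.mul_assoc]
    abel

lemma hasRealization_constMat (C : Matrix m m k) : HasRealization (constMat σ C) :=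
  ⟨Empty, inferInstance, inferInstance, C, 0, fun _ => 0, fun _ => 0, 1, by simp, by simp, by simp⟩

variable [DecidableEq m]

lemma hasRealization_scalar (a : FreeAlgebra k σ) : HasRealization (Matrix.scalar m a) := by
  classical
  induction a using FreeAlgebra.induction with
  | grade0 r =>
    convert hasRealization_constMat (σ := σ) (Matrix.scalar m r) using 1
    ext i j
    by_cases h : i = j
    · subst h; simp [constMat]
    · simp [constMat, h]
  | grade1 x =>
    refine ⟨m, inferInstance, inferInstance, 0, 1, Pi.single x 1, fun _ => 0, 1, by simp, by simp,
      ?_⟩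
    ext i j
    have h0 : constMat σ (0 : Matrix m m k) = 0 := by ext; simp [constMat]
    rw [constMat_one, h0, Matrix.mul_one, Matrix.one_mul, zero_add, linMat_apply,
      Finset.sum_eq_single x]
    · by_cases h : i = j
      · subst h; simp
      · simp [h]
    · intro l _ hl; simp [hl]
    · simp
  | mul a b ha hb => rw [map_mul]; exact ha.mul hb
  | add a b ha hb => rw [map_add]; exact ha.add hb

lemma hasRealization (p : Matrix m m (FreeAlgebra k σ)) : HasRealization p := by
  rw [matrix_eq_sum_single p]
  have h0 : HasRealization (0 : Matrix m m (FreeAlgebra k σ)) := by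
    simpa using hasRealization_scalar (m := m) (0 : FreeAlgebra k σ)
  refine Finset.sum_induction _ _ (fun _ _ => HasRealization.add) h0 fun i _ =>
    Finset.sum_induction _ _ (fun _ _ => HasRealization.add) h0 fun j _ => ?_
  have : Matrix.single i j (p i j)
      = Matrix.scalar m (p i j) * constMat σ (Matrix.single i j 1) := by
    ext a b
    rw [scalar_apply, diagonal_mul]
    simp only [constMat, map_apply, single_apply]
    split_ifs <;> simp
  rw [this]
  exact (hasRealization_scalar _).mul (hasRealization_constMat _)

/-- Linearization: a matrix over the free algebra which is the identity at the origin is stably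
associated to a monic pencil. -/
lemma exists_htpyEquiv_pencil (f : Matrix m m (FreeAlgebra k σ))
    (hf : f.map (FreeAlgebra.lift k fun _ : σ => (0 : k)) = 1) :
    ∃ (N : Type) (_ : Fintype N) (_ : DecidableEq N) (A : σ → Matrix N N k),
      HtpyEquiv f (1 - linMat A) := by
  obtain ⟨N, _, _, p₀, c, B, A, u, h₁, h₂, rfl⟩ := hasRealization f
  have hp₀ : p₀ = 1 := by
    rw [← hf]
    ext i j
    simp [constMat, mul_apply, linMat_apply]
  subst hp₀
  rw [constMat_one] at hf ⊢
  refine ⟨m ⊕ N, inferInstance, inferInstance,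
    fun l => fromBlocks (-(c * B l)) (-(c * A l)) (B l) (A l), HtpyEquiv.symm ?_⟩
  have key : 1 - linMat (fun l => fromBlocks (-(c * B l)) (-(c * A l)) (B l) (A l))
      = (fromBlocks 1 (-constMat σ c) 0 1 * fromBlocks 1 (constMat σ c * u) 0 1) *
        (fromBlocks (1 + constMat σ c * u * linMat B) 0 0 (1 - linMat A) *
          fromBlocks 1 0 (-(u * linMat B)) 1) := by
    have h₃ : constMat σ c * u * (1 - linMat A) = constMat σ c := by
      rw [Matrix.mul_assoc, h₂, Matrix.mul_one]
    have h₄ : (1 - linMat A) * (u * linMat B) = linMat B := by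
      rw [← Matrix.mul_assoc, h₁, Matrix.one_mul]
    rw [mul_assoc, fromBlocks_multiply, fromBlocks_multiply, fromBlocks_multiply,
      ← fromBlocks_linMat, linMat_neg, linMat_neg, ← constMat_mul_linMat, ← constMat_mul_linMat,
      ← fromBlocks_one, sub_eq_add_neg, fromBlocks_neg, fromBlocks_add]
    congr 1
    · simp [h₄, ← Matrix.mul_assoc]
    · simp [h₃, Matrix.mul_sub]
    · simp [h₄]
    · simp [sub_eq_add_neg]
  rw [key]
  exact (HtpyEquiv.of_isUnit_mul ((isUnit_fromBlocks_of_isUnit _ isUnit_one isUnit_one).mul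
    (isUnit_fromBlocks_of_isUnit _ isUnit_one isUnit_one))).trans
    ((HtpyEquiv.of_mul_isUnit (isUnit_fromBlocks_one_zero_one _)).trans
    (.fromBlocks_right 0 (isUnit_iff_exists.2 ⟨u, h₁, h₂⟩)))

end Linearization

section TupleModule

/-- A semisimple module maps nontrivially to every nonzero module annihilated by the annihilator
of a finite family of its elements. -/
lemma exists_linearMap_ne_zero {R M S ι : Type*} [Ring R] [AddCommGroup M] [Module R M]
    [IsSemisimpleModule R M] [AddCommGroup S] [Module R S] [Nontrivial S] [Finite ι] (b : ι → M)
    (hb : ∀ p : R, (∀ i, p • b i = 0) → ∀ s : S, p • s = 0) : ∃ φ : M →ₗ[R] S, φ ≠ 0 := by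
  classical
  obtain ⟨v, hv⟩ := exists_ne (0 : S)
  let φ : R →ₗ[R] ι → M := LinearMap.pi fun i => LinearMap.toSpanSingleton R M (b i)
  let ψ : R →ₗ[R] S := LinearMap.toSpanSingleton R S v
  have hker : LinearMap.ker φ ≤ LinearMap.ker ψ := fun p hp => by
    rw [LinearMap.mem_ker] at hp ⊢
    exact hb p (fun i => congrFun hp i) v
  obtain ⟨h, hh⟩ := IsSemisimpleModule.extension_property
    ((LinearMap.ker φ).liftQ φ le_rfl)
    (LinearMap.ker_eq_bot.1 (Submodule.ker_liftQ_eq_bot' _ _ rfl)) ((LinearMap.ker φ).liftQ ψ hker)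
  by_contra! H
  have h0 : h = 0 := LinearMap.pi_ext' fun i => by
    exact (H (h ∘ₗ LinearMap.single R (fun _ => M) i)).trans (LinearMap.zero_comp _).symm
  have := LinearMap.congr_fun hh (Submodule.Quotient.mk 1)
  rw [h0] at this
  simp [ψ] at this
  exact hv this.symm

/-- A product of two semisimple modules is semisimple. -/
lemma isSemisimpleModule_prod {R M N : Type*} [Ring R] [AddCommGroup M] [Module R M]
    [AddCommGroup N] [Module R N] [IsSemisimpleModule R M] [IsSemisimpleModule R N] :
    IsSemisimpleModule R (M × N) := by
  refine isSemisimpleModule_of_isSemisimpleModule_submodule'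
    (p := fun b : Bool => bif b then LinearMap.range (LinearMap.inl R M N)
      else LinearMap.range (LinearMap.inr R M N)) (fun b => ?_) ?_
  · cases b
    · exact .range (LinearMap.inr R M N)
    · exact .range (LinearMap.inl R M N)
  · rw [iSup_bool_eq]
    exact LinearMap.sup_range_inl_inr

variable {k σ n m : Type*} [Field k] [Fintype n] [DecidableEq n] [Fintype m] [DecidableEq m]

/-- The column space `kⁿ` as a module over the free algebra through the tuple `A`. -/
def TupleModule {k σ n : Type*} (_A : σ → Matrix n n k) : Type _ := n → k

namespace TupleModule

instance (A : σ → Matrix n n k) : AddCommGroup (TupleModule A) :=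
  inferInstanceAs (AddCommGroup (n → k))

instance (A : σ → Matrix n n k) : Module (FreeAlgebra k σ) (TupleModule A) :=
  Module.compHom (n → k)
    ((Matrix.toLinAlgEquiv' : Matrix n n k ≃ₐ[k] _).toAlgHom.comp
      (FreeAlgebra.lift k A)).toRingHom

/-- The identification of `TupleModule A` with the column space. -/
def coords (A : σ → Matrix n n k) : TupleModule A ≃+ (n → k) := AddEquiv.refl _

lemma coords_smul (A : σ → Matrix n n k) (p : FreeAlgebra k σ) (v : TupleModule A) :
    coords A (p • v) = FreeAlgebra.lift k A p *ᵥ coords A v := rfl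

lemma coords_algebraMap_smul (A : σ → Matrix n n k) (c : k) (v : TupleModule A) :
    coords A (algebraMap k (FreeAlgebra k σ) c • v) = c • coords A v := by
  rw [coords_smul, AlgHom.commutes, Algebra.algebraMap_eq_smul_one, smul_mulVec, one_mulVec]

instance (A : σ → Matrix n n k) [Nonempty n] : Nontrivial (TupleModule A) :=
  (coords A).toEquiv.nontrivial

/-- A matrix whose action on all vectors of `TupleModule A` vanishes is zero. -/
lemma lift_eq_zero (A : σ → Matrix n n k) (p : FreeAlgebra k σ)
    (h : ∀ j, p • (coords A).symm (Pi.single j 1) = 0) : FreeAlgebra.lift k A p = 0 := by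
  ext i j
  have := congrArg (coords A) (h j)
  rw [coords_smul, AddEquiv.apply_symm_apply, map_zero] at this
  simpa using congrFun this i

instance : IsSimpleModule (FreeAlgebra k σ)
    (TupleModule fun _ : σ => (0 : Matrix Unit Unit k)) := by
  rw [isSimpleModule_iff_toSpanSingleton_surjective]
  refine ⟨inferInstance, fun v hv w => ?_⟩
  set e := coords fun _ : σ => (0 : Matrix Unit Unit k) with he
  have hv' : e v () ≠ 0 := fun h => hv (e.injective (by
    rw [map_zero]; exact _root_.funext fun _ => h))
  refine ⟨algebraMap _ _ (e w () / e v ()), e.injective ?_⟩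
  rw [LinearMap.toSpanSingleton_apply, coords_algebraMap_smul]
  ext
  simpa using div_mul_cancel₀ _ hv'

end TupleModule

lemma lift_zero_unit (p : FreeAlgebra k σ) :
    FreeAlgebra.lift k (fun _ : σ => (0 : Matrix Unit Unit k)) p
      = algebraMap k _ (FreeAlgebra.lift k (fun _ => (0 : k)) p) := by
  have : FreeAlgebra.lift k (fun _ : σ => (0 : Matrix Unit Unit k))
      = (Algebra.ofId k (Matrix Unit Unit k)).comp (FreeAlgebra.lift k fun _ : σ => (0 : k)) := by
    ext x; simp
  rw [this]; rfl

open TupleModule in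
/-- Two simple tuples are isomorphic if no element of the free algebra without constant term
vanishes at one of them and takes a value `v` with `1 - v` singular at the other. -/
lemma nonempty_linearEquiv_of_isUnit_one_sub {A : σ → Matrix n n k} {B : σ → Matrix m m k}
    [IsSimpleModule (FreeAlgebra k σ) (TupleModule A)]
    [IsSimpleModule (FreeAlgebra k σ) (TupleModule B)] (hA : A ≠ 0)
    (h : ∀ p, FreeAlgebra.lift k (fun _ => (0 : k)) p = 0 → FreeAlgebra.lift k B p = 0 →
      IsUnit (1 - FreeAlgebra.lift k A p)) :
    Nonempty (TupleModule B ≃ₗ[FreeAlgebra k σ] TupleModule A) := by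
  have := IsSimpleModule.nontrivial (FreeAlgebra k σ) (TupleModule A)
  by_cases hp : ∀ p, FreeAlgebra.lift k (fun _ => (0 : k)) p = 0 → FreeAlgebra.lift k B p = 0 →
      FreeAlgebra.lift k A p = 0
  · let Z := fun _ : σ => (0 : Matrix Unit Unit k)
    have := isSemisimpleModule_prod (R := FreeAlgebra k σ) (M := TupleModule B)
      (N := TupleModule Z)
    let b : m ⊕ Unit → TupleModule B × TupleModule Z :=
      Sum.elim (fun i => ((coords B).symm (Pi.single i 1), 0))
        fun j => (0, (coords Z).symm (Pi.single j 1))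
    obtain ⟨φ, hφ⟩ := exists_linearMap_ne_zero (S := TupleModule A) b fun p hb s => by
      apply (coords A).injective
      rw [coords_smul, hp p, zero_mulVec, map_zero]
      · have := lift_eq_zero Z p fun j => congrArg Prod.snd (hb (Sum.inr j))
        rw [lift_zero_unit] at this
        simpa [Matrix.algebraMap_eq_diagonal] using congrFun (congrFun this ()) ()
      · exact lift_eq_zero B p fun j => congrArg Prod.fst (hb (Sum.inl j))
    by_cases h₁ : φ ∘ₗ LinearMap.inl _ _ _ = 0
    · by_cases h₂ : φ ∘ₗ LinearMap.inr _ _ _ = 0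
      · exact absurd (LinearMap.prod_ext (by simpa using h₁) (by simpa using h₂)) hφ
      · have hb := (LinearMap.bijective_or_eq_zero (φ ∘ₗ LinearMap.inr _ _ _)).resolve_right h₂
        refine absurd (_root_.funext fun l => ?_) hA
        rw [← FreeAlgebra.lift_ι_apply (R := k) A l]
        refine lift_eq_zero A _ fun j => ?_
        obtain ⟨u, hu⟩ := hb.2 ((coords A).symm (Pi.single j 1))
        have h0 : FreeAlgebra.ι k l • u = 0 := (coords Z).injective (by
          rw [coords_smul, FreeAlgebra.lift_ι_apply, zero_mulVec, map_zero])
        rw [← hu, ← map_smul, h0, map_zero]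
    · exact ⟨LinearEquiv.ofBijective _ ((LinearMap.bijective_or_eq_zero _).resolve_right h₁)⟩
  · push Not at hp
    obtain ⟨p, hp0, hpB, hpA⟩ := hp
    obtain ⟨v, hv⟩ : ∃ v : TupleModule A, p • v ≠ 0 := by
      by_contra! H
      exact hpA (lift_eq_zero A p fun j => H _)
    obtain ⟨q, hq⟩ := IsSimpleModule.toSpanSingleton_surjective (FreeAlgebra k σ) hv v
    rw [LinearMap.toSpanSingleton_apply, smul_smul] at hq
    have hu := h (q * p) (by rw [map_mul, hp0, mul_zero]) (by rw [map_mul, hpB, mul_zero])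
    have h0 : (1 - FreeAlgebra.lift k A (q * p)) *ᵥ coords A v = 0 := by
      rw [sub_mulVec, one_mulVec, ← coords_smul, hq, sub_self]
    obtain ⟨w, -, hw⟩ := isUnit_iff_exists.1 hu
    have : v = 0 := (coords A).injective (by
      rw [map_zero, ← one_mulVec (coords A v), ← hw, ← mulVec_mulVec, h0, mulVec_zero])
    exact absurd (by rw [this, smul_zero]) hv

end TupleModule

section Locus

variable {k σ : Type*} [Field k]

lemma isUnit_iff_isUnit_comp {m n : Type*} [Fintype m] [DecidableEq m] [Fintype n] [DecidableEq n]
    (M : Matrix m m (Matrix n n k)) : IsUnit M ↔ IsUnit (Matrix.comp m m n n k M) :=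
  (MulEquiv.isUnit_map (compRingEquiv m n k)).symm

/-- Evaluating the pencil of `A` at `X` amounts to evaluating the pencil of `X` at `A`. -/
lemma isUnit_map_lift_swap [Fintype σ] {m n : Type*} [Fintype m] [DecidableEq m] [Fintype n]
    [DecidableEq n] (A : σ → Matrix m m k) (X : σ → Matrix n n k) :
    IsUnit ((1 - linMat A).map (FreeAlgebra.lift k X)) ↔
      IsUnit ((1 - linMat X).map (FreeAlgebra.lift k A)) := by
  rw [isUnit_iff_isUnit_comp, isUnit_iff_isUnit_comp,
    ← isUnit_submatrix_equiv (Equiv.prodComm n m) (Equiv.prodComm n m)]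
  congr! 1
  ext ⟨a, i⟩ ⟨b, j⟩
  simp only [submatrix_apply, Equiv.prodComm_apply, Prod.swap_prod_mk, comp_apply, map_apply,
    Matrix.sub_apply, linMat_apply, map_sub, map_sum, map_smul, FreeAlgebra.lift_ι_apply,
    Matrix.sum_apply, Matrix.smul_apply, smul_eq_mul, one_apply, apply_ite (FreeAlgebra.lift k X),
    apply_ite (FreeAlgebra.lift k A), map_one, map_zero]
  congr 1
  · by_cases h : i = j <;> by_cases h' : a = b <;> simp [h, h', one_apply]
  · exact Finset.sum_congr rfl fun _ _ => mul_comm _ _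

/-- Pencils of simple tuples with the same free locus are stably associated. -/
lemma HtpyEquiv.of_isUnit_map_lift_iff [Fintype σ] {m n : Type} [Fintype m] [DecidableEq m]
    [Fintype n] [DecidableEq n] {A : σ → Matrix n n k} {B : σ → Matrix m m k}
    [IsSimpleModule (FreeAlgebra k σ) (TupleModule A)]
    [IsSimpleModule (FreeAlgebra k σ) (TupleModule B)] (hA : A ≠ 0)
    (h : ∀ (N : Type) [Fintype N] [DecidableEq N] (X : σ → Matrix N N k),
      IsUnit ((1 - linMat A).map (FreeAlgebra.lift k X)) ↔
        IsUnit ((1 - linMat B).map (FreeAlgebra.lift k X))) :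
    HtpyEquiv (1 - linMat A) (1 - linMat B) := by
  obtain ⟨e⟩ := nonempty_linearEquiv_of_isUnit_one_sub (A := A) (B := B) hA fun p hp hB => by
    let f : Matrix Unit Unit (FreeAlgebra k σ) := of fun _ _ => 1 - p
    obtain ⟨N, _, _, X, hX⟩ := exists_htpyEquiv_pencil f (by ext; simp [f, hp])
    have hf : IsUnit (f.map (FreeAlgebra.lift k B)) := by
      convert isUnit_one
      ext; simp [f, hB]
    have hu : IsUnit (f.map (FreeAlgebra.lift k A)) := by
      refine (hX.map (FreeAlgebra.lift k A).toRingHom).isUnit_iff.2 ?_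
      refine (isUnit_map_lift_swap _ _).1 ((h N X).2 ((isUnit_map_lift_swap _ _).2 ?_))
      exact (hX.map (FreeAlgebra.lift k B).toRingHom).isUnit_iff.1 hf
    obtain ⟨w, hw₁, hw₂⟩ := isUnit_iff_exists.1 hu
    refine isUnit_iff_exists.2 ⟨w () (), ?_, ?_⟩
    · simpa [f, mul_apply] using congrFun (congrFun hw₁ ()) ()
    · simpa [f, mul_apply] using congrFun (congrFun hw₂ ()) ()
  let E : (m → k) ≃ₗ[k] (n → k) :=
    { ((TupleModule.coords B).symm.trans e.toAddEquiv).trans (TupleModule.coords A) with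
      map_smul' := fun c v => by
        have : (TupleModule.coords B).symm (c • v)
            = algebraMap k (FreeAlgebra k σ) c • (TupleModule.coords B).symm v :=
          (TupleModule.coords B).injective (by
            rw [TupleModule.coords_algebraMap_smul]; simp)
        change TupleModule.coords A (e ((TupleModule.coords B).symm (c • v)))
          = c • TupleModule.coords A (e ((TupleModule.coords B).symm v))
        rw [this, map_smul, TupleModule.coords_algebraMap_smul] }
  have hE : ∀ l v, E (B l *ᵥ v) = A l *ᵥ E v := fun l v => by
    have : (TupleModule.coords B).symm (B l *ᵥ v)
        = FreeAlgebra.ι k l • (TupleModule.coords B).symm v :=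
      (TupleModule.coords B).injective (by
        rw [TupleModule.coords_smul, FreeAlgebra.lift_ι_apply]; simp)
    change TupleModule.coords A (e ((TupleModule.coords B).symm (B l *ᵥ v)))
      = A l *ᵥ TupleModule.coords A (e ((TupleModule.coords B).symm v))
    rw [this, map_smul, TupleModule.coords_smul, FreeAlgebra.lift_ι_apply]
  let T := LinearMap.toMatrix' E.toLinearMap
  let T' := LinearMap.toMatrix' E.symm.toLinearMap
  have h₁ : constMat σ T * constMat σ T' = 1 := by
    rw [← constMat_mul, ← LinearMap.toMatrix'_comp, LinearEquiv.comp_symm, LinearMap.toMatrix'_id,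
      constMat_one]
  have h₂ : constMat σ T' * constMat σ T = 1 := by
    rw [← constMat_mul, ← LinearMap.toMatrix'_comp, LinearEquiv.symm_comp, LinearMap.toMatrix'_id,
      constMat_one]
  have hT : ∀ l, T * B l = A l * T := fun l => by
    rw [← LinearMap.toMatrix'_toLin' (T * B l), ← LinearMap.toMatrix'_toLin' (A l * T),
      Matrix.toLin'_mul, Matrix.toLin'_mul, Matrix.toLin'_toMatrix']
    exact congrArg _ (LinearMap.ext fun v => hE l v)
  refine (HtpyEquiv.of_mul_eq_mul h₁ h₂ h₁ h₂ ?_).symm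
  rw [Matrix.mul_sub, Matrix.sub_mul, constMat_mul_linMat, linMat_mul_constMat, Matrix.mul_one,
    Matrix.one_mul]
  simp only [hT]

end Locus

section Atoms

variable {k σ : Type*} [Field k]

/-- A pencil whose tuple has a nontrivial invariant subspace is block upper triangular with
strictly smaller diagonal blocks. -/
lemma exists_fromBlocks_of_submodule [Fintype σ] {N : Type} [Fintype N] [DecidableEq N]
    (A : σ → Matrix N N k) (V : Submodule k (N → k)) (hV : ∀ l, ∀ v ∈ V, A l *ᵥ v ∈ V)
    (hbot : V ≠ ⊥) (htop : V ≠ ⊤) :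
    ∃ (w w' : ℕ) (A₁ : σ → Matrix (Fin w) (Fin w) k) (Z : σ → Matrix (Fin w) (Fin w') k)
      (A₂ : σ → Matrix (Fin w') (Fin w') k), w < Fintype.card N ∧ w' < Fintype.card N ∧
        HtpyEquiv (1 - linMat A) (fromBlocks (1 - linMat A₁) (-linMat Z) 0 (1 - linMat A₂)) := by
  obtain ⟨W, hW⟩ := V.exists_isCompl
  have hWtop : W ≠ ⊤ := fun h => hbot (by simpa [h] using hW.inf_eq_bot)
  let E : (N → k) ≃ₗ[k] (Fin (Module.finrank k V) ⊕ Fin (Module.finrank k W) → k) :=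
    (V.prodEquivOfIsCompl W hW).symm.trans
      (((Module.finBasis k V).equivFun.prodCongr (Module.finBasis k W).equivFun).trans
        (LinearEquiv.sumArrowLequivProdArrow _ _ k k).symm)
  have hE : ∀ v, (∀ i, E v (Sum.inr i) = 0) ↔ v ∈ V := fun v => by
    rw [← Submodule.prodEquivOfIsCompl_symm_apply_snd_eq_zero V W hW,
      ← (Module.finBasis k W).equivFun.map_eq_zero_iff, funext_iff]
    rfl
  let T := LinearMap.toMatrix' E.toLinearMap
  let T' := LinearMap.toMatrix' E.symm.toLinearMap
  have hTT' : T * T' = 1 := by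
    rw [← LinearMap.toMatrix'_comp, LinearEquiv.comp_symm, LinearMap.toMatrix'_id]
  have hT'T : T' * T = 1 := by
    rw [← LinearMap.toMatrix'_comp, LinearEquiv.symm_comp, LinearMap.toMatrix'_id]
  let D := fun l => T * A l * T'
  have h₂₁ : ∀ l, (D l).toBlocks₂₁ = 0 := fun l => by
    ext i j
    have h1 : E.symm (Pi.single (Sum.inl j) 1) ∈ V := (hE _).1 fun i => by simp
    have h2 := (hE _).2 (hV l _ h1) i
    have h3 : D l *ᵥ Pi.single (Sum.inl j) 1 = E (A l *ᵥ E.symm (Pi.single (Sum.inl j) 1)) := by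
      simp only [D, ← mulVec_mulVec]
      simp only [T, T', LinearMap.toMatrix'_mulVec]
      rfl
    rw [← h3] at h2
    simpa [toBlocks₂₁] using h2
  refine ⟨_, _, fun l => (D l).toBlocks₁₁, fun l => (D l).toBlocks₁₂, fun l => (D l).toBlocks₂₂,
    ?_, ?_, ?_⟩
  · simpa using Submodule.finrank_lt htop
  · simpa using Submodule.finrank_lt hWtop
  · have h₁ : constMat σ T * constMat σ T' = 1 := by rw [← constMat_mul, hTT', constMat_one]
    have h₂ : constMat σ T' * constMat σ T = 1 := by rw [← constMat_mul, hT'T, constMat_one]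
    have hD : fromBlocks (1 - linMat fun l => (D l).toBlocks₁₁) (-linMat fun l => (D l).toBlocks₁₂)
        0 (1 - linMat fun l => (D l).toBlocks₂₂) = 1 - linMat D := by
      have : D = fun l => fromBlocks (D l).toBlocks₁₁ (D l).toBlocks₁₂ 0 (D l).toBlocks₂₂ :=
        _root_.funext fun l => by rw [← h₂₁ l, fromBlocks_toBlocks]
      conv_rhs => rw [this]
      rw [← fromBlocks_linMat, linMat_zero, ← fromBlocks_one, sub_eq_add_neg, sub_eq_add_neg,
        sub_eq_add_neg, fromBlocks_neg, fromBlocks_add]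
      simp
    rw [hD]
    refine HtpyEquiv.of_mul_eq_mul h₁ h₂ h₁ h₂ ?_
    rw [Matrix.mul_sub, Matrix.sub_mul, constMat_mul_linMat, linMat_mul_constMat, Matrix.mul_one,
      Matrix.one_mul]
    simp only [D, Matrix.mul_assoc, hT'T, Matrix.mul_one]

lemma MatAtom.isUnit_or_isUnit {d : ℕ} {f : Matrix (Fin d) (Fin d) (FreeAlgebra k σ)}
    (hf : MatAtom f) {m n : Type*} [Fintype m] [DecidableEq m] [Fintype n] [DecidableEq n]
    {u : Matrix m m (FreeAlgebra k σ)} {s : Matrix m n (FreeAlgebra k σ)}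
    {v : Matrix n n (FreeAlgebra k σ)} (H : HtpyEquiv f (fromBlocks u s 0 v)) :
    IsUnit u ∨ IsUnit v := by
  by_contra! hn
  obtain ⟨P, Q, hP, hQ, h⟩ := H.exists_isUnit
  have h1 : fromBlocks (1 : Matrix (Fin d) (Fin d) (FreeAlgebra k σ)) 0 0 (fromBlocks u s 0 v)
      = fromBlocks 1 0 0 (fromBlocks 1 0 0 v) * fromBlocks 1 0 0 (fromBlocks u s 0 1) := by
    simp [fromBlocks_multiply]
  have hs : Splits (fromBlocks f 0 0 (1 : Matrix (m ⊕ n) (m ⊕ n) (FreeAlgebra k σ))) := by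
    refine ⟨P * fromBlocks 1 0 0 (fromBlocks 1 0 0 v), fromBlocks 1 0 0 (fromBlocks u s 0 1) * Q,
      by rw [h, h1]; simp only [Matrix.mul_assoc], fun hu => hn.2 ?_, fun hu => hn.1 ?_⟩
    · obtain ⟨P, rfl⟩ := hP
      rw [Units.isUnit_units_mul] at hu
      exact (HtpyEquiv.fromBlocks_one_left _).isUnit_iff.1
        ((HtpyEquiv.fromBlocks_one_left _).isUnit_iff.1 hu)
    · obtain ⟨Q, rfl⟩ := hQ
      rw [Units.isUnit_mul_units] at hu
      exact (HtpyEquiv.fromBlocks_right s isUnit_one).isUnit_iff.1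
        ((HtpyEquiv.fromBlocks_one_left _).isUnit_iff.1 hu)
  obtain ⟨a, b, hab, ha, hb⟩ := hs.of_fromBlocks_one
  exact (hf.2 a b hab).elim ha hb

/-- An atom which is the identity at the origin is stably associated to the pencil of a simple
tuple. -/
lemma MatAtom.exists_isSimpleModule [Fintype σ] {d : ℕ}
    {f : Matrix (Fin d) (Fin d) (FreeAlgebra k σ)} (hf : MatAtom f)
    (h0 : f.map (FreeAlgebra.lift k fun _ : σ => (0 : k)) = 1) :
    ∃ (N : Type) (_ : Fintype N) (_ : DecidableEq N) (A : σ → Matrix N N k),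
      HtpyEquiv f (1 - linMat A) ∧ A ≠ 0 ∧ IsSimpleModule (FreeAlgebra k σ) (TupleModule A) := by
  classical
  have hex : ∃ (c : ℕ) (N : Type) (_ : Fintype N) (_ : DecidableEq N) (A : σ → Matrix N N k),
      HtpyEquiv f (1 - linMat A) ∧ Fintype.card N = c := by
    obtain ⟨N, _, _, A, hA⟩ := exists_htpyEquiv_pencil f h0
    exact ⟨_, N, _, _, A, hA, rfl⟩
  obtain ⟨N, _, _, A, hA, hc⟩ := Nat.find_spec hex
  have hmin : ∀ (w : ℕ) (B : σ → Matrix (Fin w) (Fin w) k), HtpyEquiv f (1 - linMat B) →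
      ¬w < Fintype.card N := fun w B hB hlt =>
    Nat.find_min hex (hc ▸ hlt) ⟨Fin w, _, _, B, hB, Fintype.card_fin w⟩
  have hne : A ≠ 0 := by
    rintro rfl
    refine hf.1 (hA.isUnit ?_)
    convert isUnit_one
    exact (congrArg _ linMat_zero).trans (sub_zero _)
  have hN : Nonempty N := by
    by_contra hN
    rw [not_nonempty_iff] at hN
    exact hne (Subsingleton.elim _ _)
  refine ⟨N, _, _, A, hA, hne, (isSimpleModule_iff _ _).2 ⟨fun W => ?_⟩⟩
  by_contra! hW
  set e := TupleModule.coords A with he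
  have hsmul : ∀ (c : k) (v : N → k),
      e.symm (c • v) = algebraMap k (FreeAlgebra k σ) c • e.symm v := fun c v =>
    e.injective (by rw [he, TupleModule.coords_algebraMap_smul]; simp)
  let V : Submodule k (N → k) :=
    { carrier := e.symm ⁻¹' W
      add_mem' := fun {a b} ha hb => by
        rw [Set.mem_preimage, map_add]; exact W.add_mem ha hb
      zero_mem' := by
        rw [Set.mem_preimage, map_zero]; exact W.zero_mem
      smul_mem' := fun c v hv => by
        rw [Set.mem_preimage, hsmul]; exact W.smul_mem _ hv }
  have hV : ∀ v, e v ∈ V ↔ v ∈ W := fun v => by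
    change e.symm (e v) ∈ W ↔ _
    rw [AddEquiv.symm_apply_apply]
  obtain ⟨w, w', A₁, Z, A₂, hw, hw', H⟩ := exists_fromBlocks_of_submodule A V
    (fun l v hv => by
      obtain ⟨v, rfl⟩ := e.surjective v
      rw [← FreeAlgebra.lift_ι_apply (R := k) A l, ← TupleModule.coords_smul, hV]
      exact W.smul_mem _ ((hV _).1 hv))
    (fun h => hW.1 ((Submodule.eq_bot_iff _).2 fun v hv => e.injective (by
      rw [map_zero]; exact (Submodule.mem_bot k).1 (h ▸ (hV v).2 hv))))
    (fun h => hW.2 ((Submodule.eq_top_iff').2 fun v => (hV v).1 (h ▸ Submodule.mem_top)))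
  have H' := hA.trans H
  rcases hf.isUnit_or_isUnit H' with h | h
  · exact hmin _ _ (H'.trans (.fromBlocks_left _ h)) hw'
  · exact hmin _ _ (H'.trans (.fromBlocks_right _ h)) hw

end Atoms

section Main

/-- The free locus condition, for tuples of matrices indexed by an arbitrary finite type. -/
lemma isUnit_map_lift_iff_of_det {k : Type*} [Field k] {g d₁ d₂ : ℕ}
    {f₁ : Matrix (Fin d₁) (Fin d₁) (FreeAlgebra k (Fin g))}
    {f₂ : Matrix (Fin d₂) (Fin d₂) (FreeAlgebra k (Fin g))}
    (hloc : ∀ (n : ℕ) (X : Fin g → Matrix (Fin n) (Fin n) k),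
      (matEval f₁ X).det = 0 ↔ (matEval f₂ X).det = 0)
    (N : Type*) [Fintype N] [DecidableEq N] (X : Fin g → Matrix N N k) :
    IsUnit (f₁.map (FreeAlgebra.lift k X)) ↔ IsUnit (f₂.map (FreeAlgebra.lift k X)) := by
  let e := Matrix.reindexAlgEquiv k k (Fintype.equivFin N)
  have key : ∀ {d : ℕ} (f : Matrix (Fin d) (Fin d) (FreeAlgebra k (Fin g))),
      IsUnit (f.map (FreeAlgebra.lift k X)) ↔ ¬(matEval f fun l => e (X l)).det = 0 :=
    fun {d} f => by
      have h1 : FreeAlgebra.lift k (fun l => e (X l)) = e.toAlgHom.comp (FreeAlgebra.lift k X) := by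
        ext1
        exact _root_.funext fun x => by simp
      have h2 : matEval f (fun l => e (X l))
          = Matrix.comp _ _ _ _ k (RingEquiv.mapMatrix e.toRingEquiv (f.map (FreeAlgebra.lift k X))) := by
        ext p q
        simp [matEval, h1]
      rw [h2, ← ne_eq, ← isUnit_iff_ne_zero, ← Matrix.isUnit_iff_isUnit_det,
        ← isUnit_iff_isUnit_comp]
      exact (MulEquiv.isUnit_map (RingEquiv.mapMatrix (m := Fin d) e.toRingEquiv)).symm
  rw [key, key, hloc]

lemma isUnit_one_submatrix {R n : Type*} [Ring R] [Fintype n] [DecidableEq n]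
    (τ : Equiv.Perm n) : IsUnit ((1 : Matrix n n R).submatrix τ id) ∧
      IsUnit ((1 : Matrix n n R).submatrix id τ) := by
  have h1 : (1 : Matrix n n R).submatrix τ id * (1 : Matrix n n R).submatrix id τ = 1 := by
    rw [← submatrix_mul _ _ _ _ _ Function.bijective_id]
    simp
  have h2 : (1 : Matrix n n R).submatrix id τ * (1 : Matrix n n R).submatrix τ id = 1 := by
    rw [submatrix_mul_equiv]
    simp
  exact ⟨isUnit_iff_exists.2 ⟨_, h1, h2⟩, isUnit_iff_exists.2 ⟨_, h2, h1⟩⟩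

lemma HtpyEquiv.stablyAssociated {R : Type*} [Ring R] {d₁ d₂ : ℕ}
    {f₁ : Matrix (Fin d₁) (Fin d₁) R} {f₂ : Matrix (Fin d₂) (Fin d₂) R} (H : HtpyEquiv f₁ f₂) :
    StablyAssociated f₁ f₂ := by
  obtain ⟨P, Q, hP, hQ, h⟩ := H.exists_isUnit
  let e : Fin d₁ ⊕ Fin d₂ ≃ Fin (d₁ + d₂) := finSumFinEquiv
  let e' : Fin d₂ ⊕ Fin d₁ ≃ Fin (d₁ + d₂) := finSumFinEquiv.trans (finCongr (add_comm d₁ d₂)).symm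
  let τ : Equiv.Perm (Fin (d₁ + d₂)) := e.symm.trans ((Equiv.sumComm _ _).trans e')
  let Y := Matrix.reindex e' e' (fromBlocks f₂ 0 0 (1 : Matrix (Fin d₁) (Fin d₁) R))
  have hY : (fromBlocks (1 : Matrix (Fin d₁) (Fin d₁) R) 0 0 f₂).submatrix e.symm e.symm
      = (1 : Matrix _ _ R).submatrix τ id * Y * (1 : Matrix _ _ R).submatrix id τ := by
    rw [← submatrix_id_id Y, ← submatrix_mul _ _ _ _ _ Function.bijective_id,
      ← submatrix_mul _ _ _ _ _ Function.bijective_id, Matrix.one_mul, Matrix.mul_one]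
    ext i j
    obtain ⟨i, rfl⟩ := e.surjective i
    obtain ⟨j, rfl⟩ := e.surjective j
    rcases i with i | i <;> rcases j with j | j <;> simp [Y, τ]
  refine ⟨d₂, d₁, add_comm _ _, P.submatrix e.symm e.symm * (1 : Matrix _ _ R).submatrix τ id,
    (1 : Matrix _ _ R).submatrix id τ * Q.submatrix e.symm e.symm,
    IsUnit.mul ?_ (isUnit_one_submatrix τ).1, IsUnit.mul (isUnit_one_submatrix τ).2 ?_, ?_⟩
  · exact hP.map (Matrix.reindexRingEquiv R e)
  · exact hQ.map (Matrix.reindexRingEquiv R e)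
  · have hY' : Matrix.reindex (finCongr (add_comm d₁ d₂)).symm (finCongr (add_comm d₁ d₂)).symm
        (dSum f₂ d₁) = Y := rfl
    have h1 : dSum f₁ d₂ = (P * fromBlocks 1 0 0 f₂ * Q).submatrix e.symm e.symm := by
      rw [← h]; rfl
    rw [hY', h1, ← submatrix_mul_equiv _ _ _ e.symm, ← submatrix_mul_equiv _ _ _ e.symm, hY]
    simp only [Matrix.mul_assoc]

end Main

/-- If two atoms `f₁ ∈ M_{d₁}(k⟨x⟩)` and `f₂ ∈ M_{d₂}(k⟨x⟩)` with `fᵢ(0) = I` have the same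
free locus, then they are stably associated. -/
theorem stablyAssociated_of_eq_freeLocus
    {k : Type*} [Field k] [IsAlgClosed k] [CharZero k] {g d₁ d₂ : ℕ}
    (f₁ : Matrix (Fin d₁) (Fin d₁) (FreeAlgebra k (Fin g)))
    (f₂ : Matrix (Fin d₂) (Fin d₂) (FreeAlgebra k (Fin g)))
    (hatom₁ : MatAtom f₁) (hatom₂ : MatAtom f₂)
    (h0₁ : f₁.map ⇑(FreeAlgebra.lift k (fun _ : Fin g => (0 : k))) = 1)
    (h0₂ : f₂.map ⇑(FreeAlgebra.lift k (fun _ : Fin g => (0 : k))) = 1)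
    (hloc : ∀ (n : ℕ) (X : Fin g → Matrix (Fin n) (Fin n) k),
      (matEval f₁ X).det = 0 ↔ (matEval f₂ X).det = 0) :
    StablyAssociated f₁ f₂ := by

  obtain ⟨N, _, _, A, hA, hA0, _⟩ := hatom₁.exists_isSimpleModule h0₁
  obtain ⟨M, _, _, B, hB, -, _⟩ := hatom₂.exists_isSimpleModule h0₂
  have hAB : HtpyEquiv (1 - linMat A) (1 - linMat B) := .of_isUnit_map_lift_iff hA0
    fun n _ _ X => (hA.map (FreeAlgebra.lift k X).toRingHom).isUnit_iff.symm.trans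
      ((isUnit_map_lift_iff_of_det hloc n X).trans
        (hB.map (FreeAlgebra.lift k X).toRingHom).isUnit_iff)
  exact ((hA.trans hAB).trans hB.symm).stablyAssociated
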